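/- Let α ∈ (0,1) and 0 < β < min{α, (2/3)(1−α)}. Then for every sufficiently large integer γ, P(for every vertex set V of G(n, n^{−α}) with |V| ≤ n^β and every pair of vertices u,v ∈ V, there exists an induced path w₁w₂…w_{γ+1} on γ+1 vertices, all outside V, such that u is the only neighbor of w₁ in V, v is the only neighbor of w_{γ+1} in V, and the vertices w₂,…,w_γ have no neighbors in V) → 1 as n → ∞. -/

import Mathlib

open Filter FirstOrder

noncomputable section

/-! ### The binomial random graph `G(n,p)` -/

/-- The number of edges of a simple graph. -/
noncomputable def edgeCt {n : ℕ} (G : SimpleGraph (Fin n)) : ℕ := Nat.card G.edgeSet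

open scoped Classical in
/-- `prob n p Q` is the probability that the binomial random graph `G(n,p)` (on vertex set
`Fin n`) has property `Q`: the sum over all graphs `G` with `Q G` of
`p^{e(G)} (1-p)^{n(n-1)/2 - e(G)}`. -/
noncomputable def prob (n : ℕ) (p : ℝ) (Q : SimpleGraph (Fin n) → Prop) : ℝ :=
  ∑ G : SimpleGraph (Fin n),
    if Q G then p ^ edgeCt G * (1 - p) ^ (n * (n - 1) / 2 - edgeCt G) else 0

/-- `expec n p W` is the expectation of a real-valued function `W` of the binomial random
graph `G(n,p)`. -/
noncomputable def expec (n : ℕ) (p : ℝ) (W : SimpleGraph (Fin n) → ℝ) : ℝ :=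
  ∑ G : SimpleGraph (Fin n),
    W G * (p ^ edgeCt G * (1 - p) ^ (n * (n - 1) / 2 - edgeCt G))

/-! ### The graphs `W_a^γ` and `W_a^{γ,*}` -/

/-- `ωr r a = (r^a − 1)/(r−1)`, the number of vertices of the perfect `r`-ary tree of
depth `a − 1`. -/
def ωr (r a : ℕ) : ℕ := (r ^ a - 1) / (r - 1)

/-- The depth of the node with (0-based) breadth-first (heap) index `j` in the infinite
`r`-ary tree: the root has index 0, and the parent of node `j ≥ 1` is node `(j−1)/r`. -/
def heapDepth (r : ℕ) : ℕ → ℕ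
  | 0 => 0
  | j + 1 => heapDepth r (j / r) + 1
  decreasing_by exact Nat.lt_succ_of_le (Nat.div_le_self _ _)

/-- The vertex set of `W_a^γ`: the path `F₁` on `a` vertices (`Sum.inl`), together with,
for each of the `(4^a−1)/3` vertices `i` of the perfect 4-ary tree `F₂` (in breadth-first
order), the vertex `(i,0)` of `F₂` itself and the `γ` inner vertices `(i,1),…,(i,γ)` of the
path `P_{γ+2}` joining `i` to the vertex of `F₁` at the same distance from the root. -/
abbrev WVert (γ a : ℕ) := Fin a ⊕ (Fin (ωr 4 a) × Fin (γ + 1))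

/-- Base (directed) adjacency relation generating `W_a^γ`: consecutive `F₁`-vertices;
the last inner path vertex `(i,γ)` is joined to the `F₁`-vertex at depth of `i`;
consecutive vertices along each `P_{γ+2}`; and tree edges of the perfect 4-ary tree
(in heap indexing, `j` is the parent of `i ≥ 1` iff `j = (i−1)/4`). -/
def Wbase (γ a : ℕ) : WVert γ a → WVert γ a → Prop
  | Sum.inl u, Sum.inl v => (v : ℕ) = (u : ℕ) + 1
  | Sum.inl u, Sum.inr iv => (iv.2 : ℕ) = γ ∧ heapDepth 4 (iv.1 : ℕ) = (u : ℕ)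
  | Sum.inr _, Sum.inl _ => False
  | Sum.inr iv, Sum.inr jw =>
      (iv.1 = jw.1 ∧ (jw.2 : ℕ) = (iv.2 : ℕ) + 1) ∨
      ((iv.2 : ℕ) = 0 ∧ (jw.2 : ℕ) = 0 ∧ 1 ≤ (iv.1 : ℕ) ∧ (jw.1 : ℕ) = ((iv.1 : ℕ) - 1) / 4)

/-- The graph `W_a^γ`. -/
def WG (γ a : ℕ) : SimpleGraph (WVert γ a) := SimpleGraph.fromRel (Wbase γ a)

/-- The vertex set of `W_a^{γ,*}` (with `ω₁ = ωr r a`, `ω₂ = ωr r ω₁`), as five pieces: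
the path `F₁` on `a` vertices; the tree `F₂` together with the inner vertices of the
paths `P_{γ+2}` joining `F₂` to `F₁` (pairs `(i,k)`, `k = 0` being the `F₂`-vertex itself);
the `γ` inner vertices of the paths `P_{γ+2}` joining the `i`-th vertex of `F₂` (in
breadth-first order) to the `i`-th vertex of the path `F̃₁`; the path `F̃₁` on `ω₁`
vertices; and the tree `F̃₂` together with the inner vertices of the paths `P_{γ+2}`
joining `F̃₂` to `F̃₁`. -/
abbrev WSVert (γ r a : ℕ) :=
  Fin a ⊕ ((Fin (ωr r a) × Fin (γ + 1)) ⊕ ((Fin (ωr r a) × Fin γ) ⊕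
    (Fin (ωr r a) ⊕ (Fin (ωr r (ωr r a)) × Fin (γ + 1)))))

/-- Base (directed) adjacency relation generating `W_a^{γ,*}`. -/
def WSbase (γ r a : ℕ) : WSVert γ r a → WSVert γ r a → Prop
  | .inl u, .inl v => (v : ℕ) = (u : ℕ) + 1
  | .inl u, .inr (.inl iv) => (iv.2 : ℕ) = γ ∧ heapDepth r (iv.1 : ℕ) = (u : ℕ)
  | .inr (.inl iv), .inr (.inl jw) =>
      (iv.1 = jw.1 ∧ (jw.2 : ℕ) = (iv.2 : ℕ) + 1) ∨
      ((iv.2 : ℕ) = 0 ∧ (jw.2 : ℕ) = 0 ∧ 1 ≤ (iv.1 : ℕ) ∧ (jw.1 : ℕ) = ((iv.1 : ℕ) - 1) / r)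
  | .inr (.inl iv), .inr (.inr (.inl jm)) => (iv.2 : ℕ) = 0 ∧ iv.1 = jm.1 ∧ (jm.2 : ℕ) = 0
  | .inr (.inl iv), .inr (.inr (.inr (.inl d))) => γ = 0 ∧ (iv.2 : ℕ) = 0 ∧ (iv.1 : ℕ) = (d : ℕ)
  | .inr (.inr (.inl im)), .inr (.inr (.inl jm)) => im.1 = jm.1 ∧ (jm.2 : ℕ) = (im.2 : ℕ) + 1
  | .inr (.inr (.inl im)), .inr (.inr (.inr (.inl d))) =>
      (im.2 : ℕ) + 1 = γ ∧ (im.1 : ℕ) = (d : ℕ)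
  | .inr (.inr (.inr (.inl d))), .inr (.inr (.inr (.inl e))) => (e : ℕ) = (d : ℕ) + 1
  | .inr (.inr (.inr (.inl d))), .inr (.inr (.inr (.inr jw))) =>
      (jw.2 : ℕ) = γ ∧ heapDepth r (jw.1 : ℕ) = (d : ℕ)
  | .inr (.inr (.inr (.inr iv))), .inr (.inr (.inr (.inr jw))) =>
      (iv.1 = jw.1 ∧ (jw.2 : ℕ) = (iv.2 : ℕ) + 1) ∨
      ((iv.2 : ℕ) = 0 ∧ (jw.2 : ℕ) = 0 ∧ 1 ≤ (iv.1 : ℕ) ∧ (jw.1 : ℕ) = ((iv.1 : ℕ) - 1) / r)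
  | _, _ => False

/-- The graph `W_a^{γ,*}`. -/
def WSG (γ r a : ℕ) : SimpleGraph (WSVert γ r a) := SimpleGraph.fromRel (WSbase γ r a)

/-- `Vnum γ r a = V_{γ,r}(a) = a + 2(γ+1)ω_r(a) + (γ+1)ω_r(ω_r(a))`,
the number of vertices of `W_a^{γ,*}`. -/
def Vnum (γ r a : ℕ) : ℕ := a + 2 * (γ + 1) * ωr r a + (γ + 1) * ωr r (ωr r a)

/-- `s` is (the vertex set of) an induced copy of `H` in `G`. -/
def IsInducedCopy {V W : Type} (H : SimpleGraph W) (G : SimpleGraph V) (s : Set V) : Prop :=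
  Nonempty (H ≃g G.induce s)

/-! ### The quantities `k_γ` and `f` -/

/-- `kcoef α γ = k_γ = 2(1 − α(γ+2)/(γ+1))`. -/
def kcoef (α : ℝ) (γ : ℕ) : ℝ := 2 * (1 - α * ((γ : ℝ) + 2) / ((γ : ℝ) + 1))

/-- `ff α x = f(x) = x^α · ln x`. -/
def ff (α x : ℝ) : ℝ := x ^ α * Real.log x

/-! ### The language `L_m` and EMSO satisfaction -/

/-- Relation symbols of the language `L_m`: `m` unary symbols and one binary symbol. -/
def LRel (m : ℕ) : ℕ → Type
  | 1 => Fin m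
  | 2 => Unit
  | _ => Empty

/-- The first-order language `L_m`: one binary relation symbol, `m` unary relation symbols
and no function symbols. -/
def Lang (m : ℕ) : Language where
  Functions := fun _ => Empty
  Relations := LRel m

/-- The `L_m`-structure on `Fin n` whose binary relation is adjacency in the graph `G` and
whose `i`-th unary relation is membership in `S i`. -/
def structOf {n m : ℕ} (G : SimpleGraph (Fin n)) (S : Fin m → Set (Fin n)) :
    (Lang m).Structure (Fin n) where
  funMap := fun f _ => Empty.elim f
  RelMap := fun {k} r v =>
    match k, r, v with
    | 1, i, v => v 0 ∈ S i
    | 2, _, v => G.Adj (v 0) (v 1)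
    | 0, r, _ => Empty.elim r
    | (_ + 3), r, _ => Empty.elim r

/-- `G` EMSO-satisfies the `L_m`-sentence `φ`: there are sets `S 0, …, S (m-1)` of vertices
such that the structure on `Fin n` given by adjacency in `G` and membership in the `S i`
satisfies `φ`. -/
def EMSOSat {n m : ℕ} (G : SimpleGraph (Fin n)) (φ : (Lang m).Sentence) : Prop :=
  ∃ S : Fin m → Set (Fin n),
    @FirstOrder.Language.Sentence.Realize (Lang m) (Fin n) (structOf G S) φ

/-! ### Elementary properties of `prob` -/

section Prob

variable {n : ℕ} {p : ℝ}

open scoped Classical in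
/-- The edge set of a graph on `Fin n`, as a finite set, ranges bijectively over the subsets of
the set of all possible edges. -/
theorem prob_eq_sum_powerset (Q : SimpleGraph (Fin n) → Prop) :
    prob n p Q = ∑ E ∈ (⊤ : SimpleGraph (Fin n)).edgeFinset.powerset,
      if Q (SimpleGraph.fromEdgeSet (E : Set (Sym2 (Fin n)))) then
        p ^ E.card * (1 - p) ^ ((⊤ : SimpleGraph (Fin n)).edgeFinset \ E).card else 0 := by
  unfold prob
  refine Finset.sum_nbij' (fun G => G.edgeFinset)
    (fun E => SimpleGraph.fromEdgeSet (E : Set (Sym2 (Fin n)))) ?_ ?_ ?_ ?_ ?_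
  · intro G _
    simp only [Finset.mem_powerset]
    exact SimpleGraph.edgeFinset_mono le_top
  · intro E _
    exact Finset.mem_univ _
  · intro G _
    simp
  · intro E hE
    ext e
    have := @hE
    simp only [SimpleGraph.mem_edgeFinset, SimpleGraph.edgeSet_fromEdgeSet, Set.mem_sdiff,
      Finset.mem_coe]
    constructor
    · exact fun h => h.1
    · intro h
      refine ⟨h, ?_⟩
      have h2 := Finset.mem_powerset.1 hE h
      rw [SimpleGraph.mem_edgeFinset] at h2
      exact SimpleGraph.not_isDiag_of_mem_edgeSet _ h2
  · intro G _
    have h1 : edgeCt G = G.edgeFinset.card := by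
      unfold edgeCt
      rw [Nat.card_eq_fintype_card, SimpleGraph.edgeFinset_card]
    have h2 : ((⊤ : SimpleGraph (Fin n)).edgeFinset \ G.edgeFinset).card
        = n * (n - 1) / 2 - edgeCt G := by
      rw [Finset.card_sdiff_of_subset (SimpleGraph.edgeFinset_mono le_top),
        SimpleGraph.card_edgeFinset_top_eq_card_choose_two, Fintype.card_fin,
        Nat.choose_two_right, h1]
    rw [h2, h1]
    simp

/-- The probability that all pairs of `E₁` are edges and no pair of `E₀` is an edge. -/
theorem prob_edges {E₁ E₀ : Finset (Sym2 (Fin n))} (h₁ : ∀ e ∈ E₁, ¬ e.IsDiag)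
    (h₀ : ∀ e ∈ E₀, ¬ e.IsDiag) (h : Disjoint E₁ E₀) :
    prob n p (fun G => (∀ e ∈ E₁, e ∈ G.edgeSet) ∧ ∀ e ∈ E₀, e ∉ G.edgeSet)
      = p ^ E₁.card * (1 - p) ^ E₀.card := by
  classical
  rw [prob_eq_sum_powerset]
  set Ω := (⊤ : SimpleGraph (Fin n)).edgeFinset with hΩ
  have hmem : ∀ e : Sym2 (Fin n), e ∈ Ω ↔ ¬ e.IsDiag := by
    intro e; rw [hΩ, SimpleGraph.mem_edgeFinset, SimpleGraph.edgeSet_top]; rfl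
  have key := Finset.prod_add (fun e => if e ∈ E₀ then (0 : ℝ) else p)
    (fun e => if e ∈ E₁ then (0 : ℝ) else 1 - p) Ω
  have lhs : ∏ e ∈ Ω, ((if e ∈ E₀ then (0 : ℝ) else p) + (if e ∈ E₁ then (0 : ℝ) else 1 - p))
      = p ^ E₁.card * (1 - p) ^ E₀.card := by
    have : ∀ e ∈ Ω, ((if e ∈ E₀ then (0 : ℝ) else p) + (if e ∈ E₁ then (0 : ℝ) else 1 - p))
        = (if e ∈ E₁ then p else 1) * (if e ∈ E₀ then 1 - p else 1) := by
      intro e _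
      by_cases a : e ∈ E₁
      · have b : e ∉ E₀ := Finset.disjoint_left.1 h a
        simp [a, b]
      · by_cases b : e ∈ E₀ <;> simp [a, b]
    rw [Finset.prod_congr rfl this, Finset.prod_mul_distrib, Finset.prod_ite, Finset.prod_ite]
    have e1 : Ω.filter (· ∈ E₁) = E₁ := by
      ext e; simp only [Finset.mem_filter, hmem]; exact ⟨fun x => x.2, fun x => ⟨h₁ e x, x⟩⟩
    have e0 : Ω.filter (· ∈ E₀) = E₀ := by
      ext e; simp only [Finset.mem_filter, hmem]; exact ⟨fun x => x.2, fun x => ⟨h₀ e x, x⟩⟩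
    rw [e1, e0]; simp
  rw [← lhs, key]
  refine Finset.sum_congr rfl fun E hE => ?_
  have hE' := Finset.mem_powerset.1 hE
  have hd : ∀ e ∈ E, ¬ e.IsDiag := fun e he => (hmem e).1 (hE' he)
  have hes : ∀ e, e ∈ (SimpleGraph.fromEdgeSet (E : Set (Sym2 (Fin n)))).edgeSet ↔ e ∈ E := by
    intro e
    rw [SimpleGraph.edgeSet_fromEdgeSet]
    exact ⟨fun x => x.1, fun x => ⟨x, hd e x⟩⟩
  simp only [hes]
  split_ifs with hc
  · have r1 : ∏ e ∈ E, (if e ∈ E₀ then (0 : ℝ) else p) = p ^ E.card := by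
      rw [← Finset.prod_const]
      refine Finset.prod_congr rfl fun e he => if_neg fun h' => hc.2 e h' he
    have r2 : ∏ e ∈ Ω \ E, (if e ∈ E₁ then (0 : ℝ) else 1 - p) = (1 - p) ^ (Ω \ E).card := by
      rw [← Finset.prod_const]
      refine Finset.prod_congr rfl fun e he =>
        if_neg fun h' => (Finset.mem_sdiff.1 he).2 (hc.1 e h')
    rw [r1, r2]
  · rw [not_and_or] at hc
    symm
    rcases hc with hc | hc
    · push Not at hc
      obtain ⟨e, he, hne⟩ := hc
      rw [Finset.prod_eq_zero (i := e) (s := Ω \ E), mul_zero]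
      · exact Finset.mem_sdiff.2 ⟨(hmem e).2 (h₁ e he), hne⟩
      · simp [he]
    · push Not at hc
      obtain ⟨e, he, hne⟩ := hc
      rw [Finset.prod_eq_zero (i := e) (s := E), zero_mul]
      · exact hne
      · simp [he]

theorem prob_true : prob n p (fun _ => True) = 1 := by
  have := prob_edges (n := n) (p := p) (E₁ := ∅) (E₀ := ∅) (by simp) (by simp) (by simp)
  simpa using this

theorem prob_not (Q : SimpleGraph (Fin n) → Prop) :
    prob n p (fun G => ¬ Q G) = 1 - prob n p Q := by
  rw [← prob_true (n := n) (p := p), eq_sub_iff_add_eq]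
  unfold prob
  rw [← Finset.sum_add_distrib]
  refine Finset.sum_congr rfl fun G _ => ?_
  by_cases h : Q G <;> simp [h]

theorem edgeWeight_nonneg (h0 : 0 ≤ p) (h1 : p ≤ 1) (a b : ℕ) : 0 ≤ p ^ a * (1 - p) ^ b :=
  mul_nonneg (pow_nonneg h0 _) (pow_nonneg (sub_nonneg.2 h1) _)

theorem prob_nonneg (h0 : 0 ≤ p) (h1 : p ≤ 1) (Q : SimpleGraph (Fin n) → Prop) :
    0 ≤ prob n p Q := by
  unfold prob
  refine Finset.sum_nonneg fun G _ => ?_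
  split_ifs
  · exact edgeWeight_nonneg h0 h1 _ _
  · exact le_rfl

theorem prob_mono (h0 : 0 ≤ p) (h1 : p ≤ 1) {Q R : SimpleGraph (Fin n) → Prop}
    (h : ∀ G, Q G → R G) : prob n p Q ≤ prob n p R := by
  unfold prob
  refine Finset.sum_le_sum fun G _ => ?_
  by_cases hQ : Q G
  · rw [if_pos hQ, if_pos (h G hQ)]
  · rw [if_neg hQ]
    split_ifs
    · exact edgeWeight_nonneg h0 h1 _ _
    · exact le_rfl

open scoped Classical in
/-- The union bound. -/
theorem prob_exists_le (h0 : 0 ≤ p) (h1 : p ≤ 1) {ι : Type*} (s : Finset ι)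
    (Q : ι → SimpleGraph (Fin n) → Prop) :
    prob n p (fun G => ∃ i ∈ s, Q i G) ≤ ∑ i ∈ s, prob n p (Q i) := by
  unfold prob
  rw [Finset.sum_comm]
  refine Finset.sum_le_sum fun G _ => ?_
  have hw := edgeWeight_nonneg h0 h1 (edgeCt G) (n * (n - 1) / 2 - edgeCt G)
  have hnn : ∀ i ∈ s, 0 ≤ (if Q i G then
      p ^ edgeCt G * (1 - p) ^ (n * (n - 1) / 2 - edgeCt G) else 0) := by
    intro i _
    split_ifs
    · exact hw
    · exact le_rfl
  split_ifs with h
  · obtain ⟨i, hi, hQ⟩ := h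
    refine le_trans ?_ (Finset.single_le_sum hnn hi)
    rw [if_pos hQ]
  · exact Finset.sum_nonneg hnn

theorem prob_or_le (h0 : 0 ≤ p) (h1 : p ≤ 1) (Q R : SimpleGraph (Fin n) → Prop) :
    prob n p (fun G => Q G ∨ R G) ≤ prob n p Q + prob n p R := by
  have := prob_exists_le (n := n) h0 h1 (Finset.univ : Finset Bool) (fun b => if b then Q else R)
  simp only [Fintype.sum_bool, Finset.mem_univ, true_and, Bool.exists_bool] at this
  simp only [if_true, Bool.false_eq_true, if_false] at this
  refine le_trans (prob_mono h0 h1 fun G hG => hG.symm) this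

/-- A union bound over pairs of vertex sets. -/
theorem prob_exists_pair_le (h0 : 0 ≤ p) (h1 : p ≤ 1) (hn : 0 < n)
    (Q : Finset (Fin n) → Finset (Fin n) → SimpleGraph (Fin n) → Prop)
    (hQ : ∀ S T, prob n p (Q S T) ≤ (1 / (n : ℝ)) ^ (1 + S.card + T.card)) :
    prob n p (fun G => ∃ S T, Q S T G) ≤ Real.exp 2 / n := by
  have hn' : (0 : ℝ) < n := by exact_mod_cast hn
  have h2 : prob n p (fun G => ∃ S T, Q S T G) ≤
      ∑ x : Finset (Fin n) × Finset (Fin n), prob n p (Q x.1 x.2) := by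
    refine le_trans (prob_mono h0 h1 ?_) (prob_exists_le h0 h1 Finset.univ _)
    rintro G ⟨S, T, h⟩
    exact ⟨(S, T), Finset.mem_univ _, h⟩
  refine h2.trans ?_
  have h3 : ∑ S : Finset (Fin n), (1 / (n : ℝ)) ^ S.card = (1 / (n : ℝ) + 1) ^ n := by
    have := Finset.sum_pow_mul_eq_add_pow (1 / (n : ℝ)) 1 (Finset.univ : Finset (Fin n))
    simpa using this
  have h4 : (1 / (n : ℝ) + 1) ^ n ≤ Real.exp 1 := by
    calc (1 / (n : ℝ) + 1) ^ n ≤ (Real.exp (1 / n)) ^ n := by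
          gcongr; exact Real.add_one_le_exp _
      _ = Real.exp 1 := by
          rw [← Real.exp_nat_mul]; congr 1; field_simp
  calc ∑ x : Finset (Fin n) × Finset (Fin n), prob n p (Q x.1 x.2)
      ≤ ∑ x : Finset (Fin n) × Finset (Fin n),
          (1 / (n : ℝ)) * ((1 / (n : ℝ)) ^ x.1.card * (1 / (n : ℝ)) ^ x.2.card) := by
        refine Finset.sum_le_sum fun x _ => (hQ x.1 x.2).trans (le_of_eq ?_)
        rw [pow_add, pow_add, pow_one, mul_assoc]
    _ = (1 / (n : ℝ)) * ((1 / (n : ℝ) + 1) ^ n * (1 / (n : ℝ) + 1) ^ n) := by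
        rw [← Finset.mul_sum, Fintype.sum_prod_type, ← h3, Finset.sum_mul_sum]
    _ ≤ (1 / (n : ℝ)) * (Real.exp 1 * Real.exp 1) := by gcongr
    _ = Real.exp 2 / n := by rw [← Real.exp_add]; norm_num; ring

/-- The probability that there are no edges between two disjoint vertex sets. -/
theorem prob_no_edge_between (S R : Finset (Fin n)) (h : Disjoint S R) :
    prob n p (fun G => ∀ x ∈ S, ∀ y ∈ R, ¬ G.Adj x y) = (1 - p) ^ (S.card * R.card) := by
  classical
  have hinj : Set.InjOn (fun x : Fin n × Fin n => s(x.1, x.2)) (S ×ˢ R : Finset _) := by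
    rintro ⟨a, b⟩ hab ⟨c, d⟩ hcd e
    simp only [Finset.coe_product, Set.mem_prod, Finset.mem_coe] at hab hcd
    simp only [Sym2.eq_iff] at e
    rcases e with ⟨rfl, rfl⟩ | ⟨rfl, rfl⟩
    · rfl
    · exact absurd hcd.2 (Finset.disjoint_left.1 h hab.1)
  have := prob_edges (n := n) (p := p) (E₁ := ∅)
    (E₀ := (S ×ˢ R).image (fun x => s(x.1, x.2))) (by simp) ?_ (by simp)
  · rw [Finset.card_image_of_injOn hinj, Finset.card_product] at this
    simp only [Finset.card_empty, pow_zero, one_mul] at this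
    rw [← this]
    congr 1
    ext G
    simp only [Finset.notMem_empty, IsEmpty.forall_iff, implies_true, true_and,
      Finset.mem_image, Finset.mem_product, Prod.exists]
    constructor
    · rintro h e ⟨a, b, ⟨ha, hb⟩, rfl⟩
      exact h a ha b hb
    · intro h a ha b hb
      exact h _ ⟨a, b, ⟨ha, hb⟩, rfl⟩
  · intro e he
    simp only [Finset.mem_image, Finset.mem_product, Prod.exists] at he
    obtain ⟨a, b, ⟨ha, hb⟩, rfl⟩ := he
    rw [Sym2.mk_isDiag_iff]
    rintro rfl
    exact Finset.disjoint_left.1 h ha hb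

/-- The probability that every vertex of `K` has neighbours in both of the disjoint
sets `S` and `T`. -/
theorem prob_forall_common_le (h0 : 0 ≤ p) (h1 : p ≤ 1) (S T K : Finset (Fin n))
    (hST : Disjoint S T) (hS : Disjoint K S) (hT : Disjoint K T) :
    prob n p (fun G => ∀ x ∈ K, (∃ y ∈ S, G.Adj x y) ∧ ∃ z ∈ T, G.Adj x z)
      ≤ ((S.card : ℝ) * T.card * p ^ 2) ^ K.card := by
  classical
  let Q : ((a : Fin n) → a ∈ K → Fin n × Fin n) → SimpleGraph (Fin n) → Prop :=
    fun f G => ∀ x (hx : x ∈ K), G.Adj x (f x hx).1 ∧ G.Adj x (f x hx).2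
  have hle : prob n p (fun G => ∀ x ∈ K, (∃ y ∈ S, G.Adj x y) ∧ ∃ z ∈ T, G.Adj x z)
      ≤ ∑ f ∈ K.pi (fun _ => S ×ˢ T), prob n p (Q f) := by
    refine le_trans (prob_mono h0 h1 ?_) (prob_exists_le h0 h1 _ Q)
    intro G hG
    have hG₁ := fun x hx => (hG x hx).1
    have hG₂ := fun x hx => (hG x hx).2
    choose f hf hf' using hG₁
    choose g hg hg' using hG₂
    refine ⟨fun a ha => (f a ha, g a ha), ?_, ?_⟩
    · rw [Finset.mem_pi]
      intro a ha
      exact Finset.mem_product.2 ⟨hf a ha, hg a ha⟩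
    · exact fun x hx => ⟨hf' x hx, hg' x hx⟩
  refine hle.trans ?_
  have hQ : ∀ f ∈ K.pi (fun _ => S ×ˢ T), prob n p (Q f) ≤ (p ^ 2) ^ K.card := by
    intro f hf
    rw [Finset.mem_pi] at hf
    have hf1 : ∀ x (hx : x ∈ K), (f x hx).1 ∈ S := fun x hx => (Finset.mem_product.1 (hf x hx)).1
    have hf2 : ∀ x (hx : x ∈ K), (f x hx).2 ∈ T := fun x hx => (Finset.mem_product.1 (hf x hx)).2
    let E₁ := K.attach.image (fun x => s(x.1, (f x.1 x.2).1))
    let E₂ := K.attach.image (fun x => s(x.1, (f x.1 x.2).2))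
    have c1 : E₁.card = K.card := by
      rw [Finset.card_image_of_injective, Finset.card_attach]
      rintro ⟨a, ha⟩ ⟨b, hb⟩ e
      simp only [Sym2.eq_iff] at e
      rcases e with ⟨rfl, _⟩ | ⟨e1, _⟩
      · rfl
      · exact absurd ha (fun h => Finset.disjoint_left.1 hS h (e1 ▸ hf1 b hb))
    have c2 : E₂.card = K.card := by
      rw [Finset.card_image_of_injective, Finset.card_attach]
      rintro ⟨a, ha⟩ ⟨b, hb⟩ e
      simp only [Sym2.eq_iff] at e
      rcases e with ⟨rfl, _⟩ | ⟨e1, _⟩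
      · rfl
      · exact absurd ha (fun h => Finset.disjoint_left.1 hT h (e1 ▸ hf2 b hb))
    have hd : Disjoint E₁ E₂ := by
      rw [Finset.disjoint_left]
      intro e he1 he2
      simp only [E₁, E₂, Finset.mem_image, Finset.mem_attach, true_and, Subtype.exists] at he1 he2
      obtain ⟨a, ha, rfl⟩ := he1
      obtain ⟨b, hb, e⟩ := he2
      simp only [Sym2.eq_iff] at e
      rcases e with ⟨_, e1⟩ | ⟨e1, _⟩
      · exact Finset.disjoint_left.1 hST (hf1 a ha) (e1 ▸ hf2 b hb)
      · exact Finset.disjoint_left.1 hS hb (e1 ▸ hf1 a ha)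
    have := prob_edges (n := n) (p := p) (E₁ := E₁ ∪ E₂) (E₀ := ∅) ?_ (by simp) (by simp)
    · rw [Finset.card_union_of_disjoint hd, c1, c2] at this
      rw [← pow_mul, two_mul]
      simp only [Finset.card_empty, pow_zero, mul_one] at this
      rw [← this]
      refine prob_mono h0 h1 fun G hG => ⟨?_, by simp⟩
      intro e he
      simp only [E₁, E₂, Finset.mem_union, Finset.mem_image, Finset.mem_attach, true_and,
        Subtype.exists] at he
      rcases he with ⟨a, ha, rfl⟩ | ⟨a, ha, rfl⟩
      · exact (hG a ha).1
      · exact (hG a ha).2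
    · intro e he
      simp only [E₁, E₂, Finset.mem_union, Finset.mem_image, Finset.mem_attach, true_and,
        Subtype.exists] at he
      rcases he with ⟨a, ha, rfl⟩ | ⟨a, ha, rfl⟩ <;> rw [Sym2.mk_isDiag_iff] <;> intro e
      · exact Finset.disjoint_left.1 hS ha (e ▸ hf1 a ha)
      · exact Finset.disjoint_left.1 hT ha (e ▸ hf2 a ha)
  refine (Finset.sum_le_sum hQ).trans (le_of_eq ?_)
  rw [Finset.sum_const, Finset.card_pi, Finset.prod_const, Finset.card_product, nsmul_eq_mul]
  push_cast
  rw [mul_pow _ (p ^ 2)]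

end Prob

/-! ### Building the induced path by layers -/

section Layers

variable {W : Type*} {G : SimpleGraph W} {V : Finset W}

/-- Every vertex of `A` lies outside `S ∪ T`, has a neighbour in `S` and has no neighbour
in `T`. -/
def IsLayer (G : SimpleGraph W) (S T A : Finset W) : Prop :=
  ∀ x ∈ A, x ∉ S ∧ x ∉ T ∧ (∃ y ∈ S, G.Adj y x) ∧ ∀ z ∈ T, ¬ G.Adj x z

theorem IsLayer.subset {S T A B : Finset W} (h : IsLayer G S T A) (hB : B ⊆ A) :
    IsLayer G S T B :=
  fun x hx => h x (hB hx)

/-- `w 0, …, w k` is an induced path outside `V` whose only edge to `V` joins `w 0` to `u`. -/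
structure IsHalfPath (G : SimpleGraph W) (V : Finset W) (u : W) (k : ℕ) (w : ℕ → W) : Prop where
  notMem : ∀ i ≤ k, w i ∉ V
  inj : ∀ i ≤ k, ∀ j ≤ k, w i = w j → i = j
  adj_iff : ∀ i ≤ k, ∀ j ≤ k, (G.Adj (w i) (w j) ↔ i + 1 = j ∨ j + 1 = i)
  adj_base : ∀ i ≤ k, ∀ x ∈ V, (G.Adj (w i) x ↔ i = 0 ∧ x = u)

/-- Two half paths whose only common edge joins their last vertices form an induced path. -/
theorem IsHalfPath.join {u v : W} {k l γ : ℕ} {w w' : ℕ → W} (hw : IsHalfPath G V u k w)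
    (hw' : IsHalfPath G V v l w') (hγ : γ = k + l + 1)
    (hne : ∀ i ≤ k, ∀ j ≤ l, w i ≠ w' j)
    (hadj : ∀ i ≤ k, ∀ j ≤ l, (G.Adj (w i) (w' j) ↔ i = k ∧ j = l)) :
    ∃ z : Fin (γ + 1) → W,
      Function.Injective z ∧
      (∀ i, z i ∉ V) ∧
      (∀ i j, G.Adj (z i) (z j) ↔ ((i : ℕ) + 1 = (j : ℕ) ∨ (j : ℕ) + 1 = (i : ℕ))) ∧
      (∀ x ∈ V, G.Adj (z 0) x ↔ x = u) ∧
      (∀ x ∈ V, G.Adj (z (Fin.last γ)) x ↔ x = v) ∧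
      (∀ i : Fin (γ + 1), 0 < (i : ℕ) → (i : ℕ) < γ → ∀ x ∈ V, ¬ G.Adj (z i) x) := by
  refine ⟨fun i => if (i : ℕ) ≤ k then w i else w' (γ - i), ?_, ?_, ?_, ?_, ?_, ?_⟩
  · intro i j
    have hi := i.2
    have hj := j.2
    dsimp only
    split_ifs with hik hjk hjk
    · exact fun e => Fin.ext (hw.inj i hik j hjk e)
    · exact fun e => absurd e (hne i hik _ (by omega))
    · exact fun e => absurd e.symm (hne j hjk _ (by omega))
    · intro e
      have := hw'.inj _ (by omega) _ (by omega) e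
      exact Fin.ext (by omega)
  · intro i
    dsimp only
    split_ifs with hik
    · exact hw.notMem i hik
    · exact hw'.notMem _ (by omega)
  · intro i j
    have hi := i.2
    have hj := j.2
    dsimp only
    split_ifs with hik hjk hjk
    · exact hw.adj_iff i hik j hjk
    · rw [hadj i hik _ (by omega)]; omega
    · rw [SimpleGraph.adj_comm, hadj j hjk _ (by omega)]; omega
    · rw [hw'.adj_iff _ (by omega) _ (by omega)]; omega
  · intro x hx
    simpa using hw.adj_base 0 (by omega) x hx
  · intro x hx
    have : ¬ γ ≤ k := by omega
    simpa [this] using hw'.adj_base 0 (by omega) x hx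
  · intro i h0 hi x hx
    dsimp only
    split_ifs with hik
    · rw [hw.adj_base i hik x hx]; omega
    · rw [hw'.adj_base _ (by omega) x hx]; omega

/-- Every vertex of `A` is the end of a half path on `k + 1` vertices starting next to `u`, whose
other vertices lie in `F`. -/
structure IsSide (G : SimpleGraph W) (V : Finset W) (u : W) (k : ℕ) (F A : Finset W) : Prop where
  inner_notMem : ∀ x ∈ F, x ∉ V
  front_notMem : ∀ x ∈ A, x ∉ V
  front_notMem_inner : ∀ x ∈ A, x ∉ F
  path : ∀ a ∈ A, ∃ w, IsHalfPath G V u k w ∧ w k = a ∧ ∀ i < k, w i ∈ F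

variable [DecidableEq W]

theorem IsSide.init {u : W} {T A : Finset W} (hu : u ∈ V) (hT : V \ {u} ⊆ T)
    (hA : IsLayer G {u} T A) : IsSide G V u 0 ∅ A := by
  have hAV : ∀ x ∈ A, x ∉ V := by
    intro x hx hxV
    obtain ⟨h1, h2, -⟩ := hA x hx
    exact h2 (hT (Finset.mem_sdiff.2 ⟨hxV, h1⟩))
  refine ⟨by simp, hAV, by simp, fun a ha => ⟨fun _ => a, ⟨?_, ?_, ?_, ?_⟩, rfl, by simp⟩⟩
  · exact fun _ _ => hAV a ha
  · intro i hi j hj _; omega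
  · intro i hi j hj
    simp only [SimpleGraph.irrefl, false_iff]; omega
  · intro i hi x hx
    obtain ⟨h1, h2, ⟨y, hy, h3⟩, h4⟩ := hA a ha
    rw [Finset.mem_singleton] at hy
    subst hy
    constructor
    · intro h
      refine ⟨by omega, ?_⟩
      by_contra hne
      exact h4 x (hT (Finset.mem_sdiff.2 ⟨hx, by simpa using hne⟩)) h
    · rintro ⟨-, rfl⟩
      exact h3.symm

theorem IsSide.extend {u : W} {k : ℕ} {F A T A' : Finset W} (h : IsSide G V u k F A)
    (hT : V ∪ F ⊆ T) (hA : IsLayer G A T A') : IsSide G V u (k + 1) (F ∪ A) A' := by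
  have hAV : ∀ x ∈ A', x ∉ V := fun x hx hxV =>
    (hA x hx).2.1 (hT (Finset.mem_union_left _ hxV))
  have hAF : ∀ x ∈ A', x ∉ F := fun x hx hxV =>
    (hA x hx).2.1 (hT (Finset.mem_union_right _ hxV))
  refine ⟨?_, hAV, ?_, ?_⟩
  · intro x hx
    rcases Finset.mem_union.1 hx with hx | hx
    · exact h.inner_notMem x hx
    · exact h.front_notMem x hx
  · intro x hx hx'
    rcases Finset.mem_union.1 hx' with h' | h'
    · exact hAF x hx h'
    · exact (hA x hx).1 h'
  · intro b hb
    obtain ⟨h1, h2, ⟨a, ha, hab⟩, h4⟩ := hA b hb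
    obtain ⟨w, hw, hwk, hwF⟩ := h.path a ha
    have hnF : ∀ i < k, ¬ G.Adj b (w i) := fun i hi =>
      h4 _ (hT (Finset.mem_union_right _ (hwF i hi)))
    have hmem : ∀ i ≤ k, w i ∈ F ∪ A := by
      intro i hi
      rcases hi.lt_or_eq with hi | rfl
      · exact Finset.mem_union_left _ (hwF i hi)
      · exact Finset.mem_union_right _ (hwk ▸ ha)
    have hne : ∀ i ≤ k, w i ≠ b := by
      intro i hi e
      rcases Finset.mem_union.1 (e ▸ hmem i hi) with h' | h'
      · exact hAF b hb h'
      · exact h1 h'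
    have hadj : ∀ i ≤ k, (G.Adj b (w i) ↔ i = k) := by
      intro i hi
      constructor
      · intro h'
        by_contra hik
        exact hnF i (by omega) h'
      · rintro rfl
        rw [hwk]; exact hab.symm
    refine ⟨fun i => if i ≤ k then w i else b, ⟨?_, ?_, ?_, ?_⟩, by simp, ?_⟩
    · intro i hi
      split_ifs with hik
      · exact hw.notMem i hik
      · exact hAV b hb
    · intro i hi j hj
      split_ifs with hik hjk hjk
      · exact hw.inj i hik j hjk
      · exact fun e => absurd e (hne i hik)
      · exact fun e => absurd e.symm (hne j hjk)
      · intro _; omega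
    · intro i hi j hj
      split_ifs with hik hjk hjk
      · exact hw.adj_iff i hik j hjk
      · rw [SimpleGraph.adj_comm, hadj i hik]; omega
      · rw [hadj j hjk]; omega
      · simp only [SimpleGraph.irrefl, false_iff]; omega
    · intro i hi x hx
      split_ifs with hik
      · exact hw.adj_base i hik x hx
      · constructor
        · intro h'
          exact absurd h' (h4 x (hT (Finset.mem_union_left _ hx)))
        · rintro ⟨rfl, -⟩; omega
    · intro i hi
      have : i ≤ k := by omega
      simp only [this, if_true]
      exact hmem i this

/-- Two sides, growing from `u` and from `v`, with no edges between them, whose fronts have `a`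
and `b` vertices and which have at most `M` vertices altogether. -/
def HasSides (G : SimpleGraph W) (V : Finset W) (u v : W) (k l a b M : ℕ) : Prop :=
  ∃ F A F' B : Finset W, IsSide G V u k F A ∧ IsSide G V v l F' B ∧
    (∀ x ∈ F ∪ A, ∀ y ∈ F' ∪ B, x ≠ y ∧ ¬ G.Adj x y) ∧
    A.card = a ∧ B.card = b ∧ F.card + A.card + F'.card + B.card ≤ M

theorem HasSides.symm {u v : W} {k l a b M : ℕ} (h : HasSides G V u v k l a b M) :
    HasSides G V v u l k b a M := by
  obtain ⟨F, A, F', B, h1, h2, h3, h4, h5, h6⟩ := h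
  refine ⟨F', B, F, A, h2, h1, fun x hx y hy => ?_, h5, h4, by omega⟩
  obtain ⟨h, h'⟩ := h3 y hy x hx
  exact ⟨h.symm, fun e => h' e.symm⟩

/-- Vertex sets of moderate size expand, even outside of the closed neighbourhood of another
set. -/
def Expands (G : SimpleGraph W) (Z D E : ℝ) : Prop :=
  ∀ S T : Finset W, Disjoint S T → S.Nonempty → (S.card : ℝ) ≤ Z → (T.card : ℝ) ≤ Z →
    (T.card : ℝ) ≤ S.card * D → ∃ A, (S.card : ℝ) * E ≤ A.card ∧ IsLayer G S T A

/-- Disjoint vertex sets of size at least `Y` are joined by an edge. -/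
def Connects (G : SimpleGraph W) (Y : ℝ) : Prop :=
  ∀ S R : Finset W, Disjoint S R → Y ≤ S.card → Y ≤ R.card → ∃ x ∈ S, ∃ y ∈ R, G.Adj x y

variable {Z D E Y : ℝ}

theorem IsSide.exists_layer {u : W} {k M : ℕ} {F A F' B : Finset W}
    (hexp : Expands G Z D E) (h : IsSide G V u k F A) (hc : ∀ x ∈ F ∪ A, ∀ y ∈ F' ∪ B, x ≠ y ∧ ¬ G.Adj x y)
    (hM : F.card + A.card + F'.card + B.card ≤ M) (ha : 0 < A.card)
    (hZ : (V.card : ℝ) + M ≤ Z) (hD : (V.card : ℝ) + M ≤ A.card * D) :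
    ∃ A', (A.card : ℝ) * E ≤ A'.card ∧ IsLayer G A (V ∪ F ∪ (F' ∪ B)) A' := by
  have hcard : ((V ∪ F ∪ (F' ∪ B)).card : ℝ) ≤ V.card + M := by
    have h1 := Finset.card_union_le (V ∪ F) (F' ∪ B)
    have h2 := Finset.card_union_le V F
    have h3 := Finset.card_union_le F' B
    have : (V ∪ F ∪ (F' ∪ B)).card ≤ V.card + M := by omega
    exact_mod_cast this
  have hAM : (A.card : ℝ) ≤ M := by
    have : A.card ≤ M := by omega
    exact_mod_cast this
  have hV : (0 : ℝ) ≤ V.card := Nat.cast_nonneg _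
  refine hexp A _ ?_ (Finset.card_pos.1 ha) (by linarith) (hcard.trans hZ) (hcard.trans hD)
  rw [Finset.disjoint_left]
  intro x hx hx'
  rcases Finset.mem_union.1 hx' with hx' | hx'
  · rcases Finset.mem_union.1 hx' with hx' | hx'
    · exact h.front_notMem x hx hx'
    · exact h.front_notMem_inner x hx hx'
  · exact (hc x (Finset.mem_union_right _ hx) x hx').1 rfl

theorem HasSides.step {u v : W} {k l a b M a' : ℕ} (hexp : Expands G Z D E)
    (h : HasSides G V u v k l a b M) (ha : 0 < a)
    (hZ : (V.card : ℝ) + M ≤ Z) (hD : (V.card : ℝ) + M ≤ a * D) (ha' : (a' : ℝ) ≤ a * E) :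
    HasSides G V u v (k + 1) l a' b (M + a') := by
  obtain ⟨F, A, F', B, h1, h2, h3, rfl, h5, h6⟩ := h
  obtain ⟨A₀, hA₀, hL⟩ := h1.exists_layer hexp h3 h6 ha hZ hD
  obtain ⟨A', hsub, hcard⟩ := Finset.exists_subset_card_eq (s := A₀) (n := a')
    (by exact_mod_cast ha'.trans hA₀)
  have hL' := hL.subset hsub
  refine ⟨F ∪ A, A', F', B, h1.extend Finset.subset_union_left hL', h2, ?_, hcard, h5, ?_⟩
  · intro x hx y hy
    rcases Finset.mem_union.1 hx with hx | hx
    · exact h3 x hx y hy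
    · obtain ⟨-, e2, -, e4⟩ := hL' x hx
      have hy' := Finset.mem_union_right (V ∪ F) hy
      exact ⟨fun e => e2 (e ▸ hy'), e4 y hy'⟩
  · have := Finset.card_union_le F A
    omega

theorem HasSides.init {u v : W} (hexp : Expands G Z D E) (hu : u ∈ V) (hv : v ∈ V)
    (hZ : (V.card : ℝ) + 1 ≤ Z) (hD : (V.card : ℝ) + 1 ≤ D) (hE : 1 ≤ E) :
    HasSides G V u v 0 0 1 1 2 := by
  have hV : (0 : ℝ) ≤ V.card := Nat.cast_nonneg _
  have hcard : ∀ x, ((V \ {x}).card : ℝ) ≤ V.card := fun x => by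
    exact_mod_cast Finset.card_le_card Finset.sdiff_subset
  have hone : ∀ A : Finset W, 1 * E ≤ (A.card : ℝ) → ∃ x, x ∈ A := by
    intro A hA
    have : (0 : ℝ) < A.card := by linarith
    exact Finset.card_pos.1 (by exact_mod_cast this)
  obtain ⟨A, hA, hL⟩ := hexp {u} (V \ {u}) (by simp) (by simp) (by simp; linarith)
    ((hcard u).trans (by linarith)) (by simpa using (hcard u).trans (by linarith))
  obtain ⟨a, ha⟩ := hone A (by simpa using hA)
  have hLa : IsLayer G {u} (V \ {u}) {a} := hL.subset (by simpa using ha)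
  have hs := IsSide.init hu (le_refl _) hLa
  have haV := hs.front_notMem a (by simp)
  have hcard' : ((V \ {v} ∪ {a}).card : ℝ) ≤ V.card + 1 := by
    have h1 := Finset.card_union_le (V \ {v}) {a}
    have h2 : (V \ {v}).card ≤ V.card := Finset.card_le_card Finset.sdiff_subset
    rw [Finset.card_singleton] at h1
    have : (V \ {v} ∪ {a}).card ≤ V.card + 1 := by omega
    exact_mod_cast this
  have hdisj : Disjoint {v} (V \ {v} ∪ {a}) := by
    simp only [Finset.disjoint_singleton_left, Finset.mem_union, Finset.mem_sdiff,
      Finset.mem_singleton, not_true_eq_false, and_false, false_or]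
    rintro rfl
    exact haV hv
  obtain ⟨B, hB, hM⟩ := hexp {v} (V \ {v} ∪ {a}) hdisj (by simp) (by simp; linarith)
    (hcard'.trans (by linarith)) (by simpa using hcard'.trans (by linarith))
  obtain ⟨b, hb⟩ := hone B (by simpa using hB)
  have hMb : IsLayer G {v} (V \ {v} ∪ {a}) {b} := hM.subset (by simpa using hb)
  refine ⟨∅, {a}, ∅, {b}, hs, IsSide.init hv Finset.subset_union_left hMb, ?_, by simp, by simp,
    by simp⟩
  intro x hx y hy
  simp only [Finset.empty_union, Finset.mem_singleton] at hx hy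
  subst hx hy
  obtain ⟨-, e2, -, e4⟩ := hMb y (by simp)
  exact ⟨fun e => e2 (by simp [e]), fun e => e4 x (by simp) e.symm⟩

theorem HasSides.grow {u v : W} {γ t q : ℕ} (hexp : Expands G Z D E) (hu : u ∈ V) (hv : v ∈ V)
    (hγ : 2 * t + 3 ≤ γ) (hq : 1 ≤ q) (hqE : (q : ℝ) ≤ E)
    (hZ : (V.card : ℝ) + γ * (q : ℝ) ^ t ≤ Z) (hD : (V.card : ℝ) + γ * q ≤ D) :
    HasSides G V u v (γ - 3 - 2 * t + t) t (q ^ t) (q ^ t) (γ * q ^ t) := by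
  have hV : (0 : ℝ) ≤ V.card := Nat.cast_nonneg _
  have hq1 : (1 : ℝ) ≤ q := by exact_mod_cast hq
  have hZ' : ∀ i ≤ t, ∀ M : ℕ, M ≤ γ * q ^ i → (V.card : ℝ) + M ≤ Z := by
    intro i hi M hM
    have h1 : (M : ℝ) ≤ γ * (q : ℝ) ^ i := by exact_mod_cast hM
    have h2 : (q : ℝ) ^ i ≤ (q : ℝ) ^ t := pow_le_pow_right₀ hq1 hi
    have h3 : (γ : ℝ) * (q : ℝ) ^ i ≤ γ * (q : ℝ) ^ t := by gcongr
    linarith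
  have hD' : ∀ i, ∀ M : ℕ, M ≤ γ * q ^ (i + 1) → (V.card : ℝ) + M ≤ (q ^ i : ℕ) * D := by
    intro i M hM
    have h1 : (M : ℝ) ≤ γ * (q : ℝ) ^ (i + 1) := by exact_mod_cast hM
    have h2 : (1 : ℝ) ≤ (q : ℝ) ^ i := one_le_pow₀ hq1
    have h3 : (q : ℝ) ^ i * (V.card + γ * q) ≤ (q : ℝ) ^ i * D := by gcongr
    push_cast
    rw [pow_succ] at h1
    nlinarith
  have hγ1 : γ ≤ γ * q ^ 0 := by simp
  have hγq : γ ≤ γ * q ^ (0 + 1) := by simpa using Nat.le_mul_of_pos_right γ hq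
  have hstart : ∀ c, c ≤ γ - 3 - 2 * t → HasSides G V u v c 0 1 1 (2 + c) := by
    intro c
    induction c with
    | zero =>
      intro _
      refine HasSides.init hexp hu hv ?_ ?_ (hq1.trans hqE)
      · exact_mod_cast hZ' 0 (Nat.zero_le _) 1 (by omega)
      · simpa using hD' 0 1 (by omega)
    | succ c ih =>
      intro hc
      refine (ih (by omega)).step hexp one_pos (hZ' 0 (Nat.zero_le _) (2 + c) (by omega)) ?_ ?_
      · simpa using hD' 0 (2 + c) (by omega)
      · simpa using hq1.trans hqE
  set c := γ - 3 - 2 * t with hcdef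
  have main : ∀ i ≤ t, HasSides G V u v (c + i) i (q ^ i) (q ^ i) (2 + c + 2 * i * q ^ i) := by
    intro i
    induction i with
    | zero => intro _; simpa using hstart c le_rfl
    | succ i ih =>
      intro hi
      have hpos : 0 < q ^ i := Nat.pow_pos hq
      have hle : q ^ i ≤ q ^ (i + 1) := Nat.pow_le_pow_right hq (by omega)
      have hiq : i * q ^ i ≤ i * q ^ (i + 1) := Nat.mul_le_mul_left _ hle
      have hcq : 2 + c ≤ (2 + c) * q ^ (i + 1) := Nat.le_mul_of_pos_right _ (Nat.pow_pos hq)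
      have hγc : (2 + c + 2 * i + 1) * q ^ (i + 1) ≤ γ * q ^ (i + 1) :=
        Nat.mul_le_mul_right _ (by omega)
      have hM2 : 2 + c + 2 * i * q ^ i + q ^ (i + 1) ≤ γ * q ^ (i + 1) := by
        refine le_trans ?_ hγc
        nlinarith
      have hM1 : 2 + c + 2 * i * q ^ i ≤ γ * q ^ (i + 1) := by omega
      have hE' : ((q ^ (i + 1) : ℕ) : ℝ) ≤ (q ^ i : ℕ) * E := by
        push_cast
        rw [pow_succ]
        gcongr
      have s1 := (ih (by omega)).step hexp hpos (hZ' _ hi _ hM1) (hD' _ _ hM1) hE'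
      have s2 := s1.symm.step hexp hpos (hZ' _ hi _ hM2) (hD' _ _ hM2) hE'
      obtain ⟨F, A, F', B, r1, r2, r3, r4, r5, r6⟩ := s2.symm
      refine ⟨F, A, F', B, r1, r2, r3, r4, r5, r6.trans ?_⟩
      nlinarith
  obtain ⟨F, A, F', B, r1, r2, r3, r4, r5, r6⟩ := main t le_rfl
  refine ⟨F, A, F', B, r1, r2, r3, r4, r5, r6.trans ?_⟩
  have hcq : 2 + c ≤ (2 + c) * q ^ t := Nat.le_mul_of_pos_right _ (Nat.pow_pos hq)
  have hγc : (2 + c + 2 * t) * q ^ t ≤ γ * q ^ t := Nat.mul_le_mul_right _ (by omega)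
  nlinarith

/-- Expansion and connection together yield the required induced path. -/
theorem exists_inducedPath_of_expands {u v : W} {γ t q : ℕ} (hexp : Expands G Z D E)
    (hcon : Connects G Y) (hu : u ∈ V) (hv : v ∈ V)
    (hγ : 2 * t + 3 ≤ γ) (hq : 1 ≤ q) (hqE : (q : ℝ) ≤ E)
    (hZ : (V.card : ℝ) + γ * (q : ℝ) ^ t ≤ Z) (hD : (V.card : ℝ) + γ * q ≤ D)
    (hY : Y ≤ (q : ℝ) ^ t * E) :
    ∃ z : Fin (γ + 1) → W,
      Function.Injective z ∧
      (∀ i, z i ∉ V) ∧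
      (∀ i j, G.Adj (z i) (z j) ↔ ((i : ℕ) + 1 = (j : ℕ) ∨ (j : ℕ) + 1 = (i : ℕ))) ∧
      (∀ x ∈ V, G.Adj (z 0) x ↔ x = u) ∧
      (∀ x ∈ V, G.Adj (z (Fin.last γ)) x ↔ x = v) ∧
      (∀ i : Fin (γ + 1), 0 < (i : ℕ) → (i : ℕ) < γ → ∀ x ∈ V, ¬ G.Adj (z i) x) := by
  obtain ⟨F, A, F', B, h1, h2, h3, h4, h5, h6⟩ := HasSides.grow hexp hu hv hγ hq hqE hZ hD
  have hq1 : (1 : ℝ) ≤ q := by exact_mod_cast hq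
  have hpos : 0 < q ^ t := Nat.pow_pos hq
  have hV : (0 : ℝ) ≤ V.card := Nat.cast_nonneg _
  have hZ' : (V.card : ℝ) + (γ * q ^ t : ℕ) ≤ Z := by push_cast; exact hZ
  have hD' : (V.card : ℝ) + (γ * q ^ t : ℕ) ≤ (q ^ t : ℕ) * D := by
    have e1 : (1 : ℝ) ≤ (q : ℝ) ^ t := one_le_pow₀ hq1
    have e2 : (q : ℝ) ^ t * (V.card + γ * q) ≤ (q : ℝ) ^ t * D := by gcongr
    have e3 : (γ : ℝ) * (q : ℝ) ^ t * 1 ≤ (γ : ℝ) * (q : ℝ) ^ t * q := by gcongr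
    push_cast
    nlinarith
  have h3' : ∀ x ∈ F' ∪ B, ∀ y ∈ F ∪ A, x ≠ y ∧ ¬ G.Adj x y := fun x hx y hy =>
    ⟨(h3 y hy x hx).1.symm, fun e => (h3 y hy x hx).2 e.symm⟩
  obtain ⟨A', hA', hL⟩ := h1.exists_layer hexp h3 h6 (by omega) hZ' (by rwa [h4])
  obtain ⟨B', hB', hM⟩ := h2.exists_layer hexp h3' (M := γ * q ^ t) (by omega) (by omega) hZ'
    (by rwa [h5])
  rw [h4] at hA'
  rw [h5] at hB'
  push_cast at hA' hB'
  have hdisj : ∀ x ∈ A', ∀ y ∈ B', x ≠ y := by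
    rintro x hx y hy rfl
    obtain ⟨-, -, ⟨b, hb, hbx⟩, -⟩ := hM x hy
    obtain ⟨-, -, -, e4⟩ := hL x hx
    exact e4 b (by simp [hb]) hbx.symm
  obtain ⟨a, ha, b, hb, hab⟩ := hcon A' B'
    (Finset.disjoint_left.2 fun x hx hx' => hdisj x hx x hx' rfl) (hY.trans hA') (hY.trans hB')
  have k1 := h1.extend Finset.subset_union_left hL
  have k2 := h2.extend Finset.subset_union_left hM
  obtain ⟨w, hw, hwa, hwF⟩ := k1.path a ha
  obtain ⟨w', hw', hwb, hwF'⟩ := k2.path b hb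
  have haT := (hL a ha).2.1
  have haN := (hL a ha).2.2.2
  have hbT := (hM b hb).2.1
  have hbN := (hM b hb).2.2.2
  have hFT : ∀ y ∈ F' ∪ B, y ∈ V ∪ F ∪ (F' ∪ B) := fun y hy => Finset.mem_union_right _ hy
  have hFT' : ∀ y ∈ F ∪ A, y ∈ V ∪ F' ∪ (F ∪ A) := fun y hy => Finset.mem_union_right _ hy
  refine hw.join hw' (by omega) ?_ ?_
  · intro i hi j hj
    rcases hi.lt_or_eq with hi | rfl <;> rcases hj.lt_or_eq with hj | rfl
    · exact (h3 _ (hwF i hi) _ (hwF' j hj)).1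
    · exact fun e => hbT (hFT' _ (by rw [← hwb, ← e]; exact hwF i hi))
    · exact fun e => haT (hFT _ (by rw [← hwa, e]; exact hwF' j hj))
    · rw [hwa, hwb]; exact hdisj a ha b hb
  · intro i hi j hj
    rcases hi.lt_or_eq with hi | rfl <;> rcases hj.lt_or_eq with hj | rfl
    · simp only [(h3 _ (hwF i hi) _ (hwF' j hj)).2, false_iff]; omega
    · rw [hwb]
      have := hbN _ (hFT' _ (hwF i hi))
      simp only [SimpleGraph.adj_comm, this, false_iff]; omega
    · rw [hwa]
      have := haN _ (hFT _ (hwF' j hj))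
      simp only [this, false_iff]; omega
    · simp [hwa, hwb, hab]

end Layers

/-! ### Expansion in the binomial random graph -/

section RandomExpansion

variable {n : ℕ} {p b L : ℝ}

theorem exp_neg_le_one_div_pow (hn : 0 < n) {m : ℕ} {x : ℝ} (h : m * Real.log n ≤ x) :
    Real.exp (-x) ≤ (1 / (n : ℝ)) ^ m := by
  have hn' : (0 : ℝ) < n := by exact_mod_cast hn
  calc Real.exp (-x) ≤ Real.exp (m * -Real.log n) := by
        apply Real.exp_le_exp.2; linarith
    _ = (1 / (n : ℝ)) ^ m := by
        rw [Real.exp_nat_mul, Real.exp_neg, Real.exp_log hn', one_div]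

theorem one_sub_pow_le (hn : 0 < n) (h1 : p ≤ 1) {m N : ℕ} (h : m * Real.log n ≤ p * N) :
    (1 - p) ^ N ≤ (1 / (n : ℝ)) ^ m := by
  refine le_trans ?_ (exp_neg_le_one_div_pow hn h)
  calc (1 - p) ^ N ≤ Real.exp (-p) ^ N :=
        pow_le_pow_left₀ (by linarith) (Real.one_sub_le_exp_neg p) N
    _ = Real.exp (-(p * N)) := by rw [← Real.exp_nat_mul]; congr 1; ring

/-- A moderate set `S` with all its neighbours in a small set `T`. -/
def IsTrapped (p b : ℝ) (S T : Finset (Fin n)) (G : SimpleGraph (Fin n)) : Prop :=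
  S.Nonempty ∧ (S.card : ℝ) ≤ 1 / (p * b ^ 4) ∧ (T.card : ℝ) ≤ S.card * (n * p / b) ∧
    ∀ x ∈ S, ∀ y, y ∉ S → y ∉ T → ¬ G.Adj x y

/-- Two disjoint large sets without edges between them. -/
def IsSeparated (p b : ℝ) (S R : Finset (Fin n)) (G : SimpleGraph (Fin n)) : Prop :=
  Disjoint S R ∧ b / p ≤ S.card ∧ b / p ≤ R.card ∧ ∀ x ∈ S, ∀ y ∈ R, ¬ G.Adj x y

/-- Two disjoint sets with many common neighbours outside of them. -/
def IsOverlapping (p b : ℝ) (S T : Finset (Fin n)) (G : SimpleGraph (Fin n)) : Prop :=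
  Disjoint S T ∧ S.Nonempty ∧ ∃ K : Finset (Fin n), Disjoint K S ∧ Disjoint K T ∧
    b * (S.card + T.card + n * p ^ 2 * (S.card * T.card)) ≤ K.card ∧
    ∀ x ∈ K, (∃ y ∈ S, G.Adj x y) ∧ ∃ z ∈ T, G.Adj x z

theorem prob_const_and_le (h0 : 0 ≤ p) (h1 : p ≤ 1) {c : Prop} {Q : SimpleGraph (Fin n) → Prop}
    {x : ℝ} (hx : 0 ≤ x) (h : c → prob n p Q ≤ x) : prob n p (fun G => c ∧ Q G) ≤ x := by
  by_cases hc : c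
  · exact (prob_mono h0 h1 fun G hG => hG.2).trans (h hc)
  · simpa [prob, hc] using hx

theorem prob_isTrapped_le (hn : 0 < n) (h0 : 0 < p) (h1 : p ≤ 1) (hb : 5 ≤ b)
    (hlog : 6 * Real.log n ≤ b) (hd : b ^ 5 ≤ n * p) (S T : Finset (Fin n)) :
    prob n p (IsTrapped p b S T) ≤ (1 / (n : ℝ)) ^ (1 + S.card + T.card) := by
  have hn' : (0 : ℝ) < n := by exact_mod_cast hn
  have hb0 : 0 < b := by linarith
  have hlog0 : 0 ≤ Real.log n := Real.log_natCast_nonneg n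
  refine le_trans (prob_mono h0.le h1 (R := fun G => (S.Nonempty ∧
    (S.card : ℝ) ≤ 1 / (p * b ^ 4) ∧ (T.card : ℝ) ≤ S.card * (n * p / b)) ∧
    ∀ x ∈ S, ∀ y ∈ (S ∪ T)ᶜ, ¬ G.Adj x y) ?_) (prob_const_and_le h0.le h1 (by positivity) ?_)
  · rintro G ⟨a1, a2, a3, a4⟩
    refine ⟨⟨a1, a2, a3⟩, fun x hx y hy => ?_⟩
    simp only [Finset.mem_compl, Finset.mem_union, not_or] at hy
    exact a4 x hx y hy.1 hy.2
  · rintro ⟨a1, a2, a3⟩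
    rw [prob_no_edge_between]
    · apply one_sub_pow_le hn h1
      have hs1 : (1 : ℝ) ≤ S.card := by exact_mod_cast Finset.card_pos.2 a1
      set s : ℝ := (S.card : ℝ) with hs
      set t : ℝ := (T.card : ℝ) with ht
      have hr : (n : ℝ) - s - t ≤ ((S ∪ T)ᶜ.card : ℝ) := by
        have e1 := Finset.card_union_le S T
        have e2 := Finset.card_add_card_compl (S ∪ T)
        rw [Fintype.card_fin] at e2
        have : n ≤ (S ∪ T)ᶜ.card + S.card + T.card := by omega
        have : (n : ℝ) ≤ ((S ∪ T)ᶜ.card : ℝ) + S.card + T.card := by exact_mod_cast this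
        linarith
      have b4 : (625 : ℝ) ≤ b ^ 4 := by
        calc (625 : ℝ) = 5 ^ 4 := by norm_num
          _ ≤ b ^ 4 := by gcongr
      have hps : s * p * b ^ 4 ≤ 1 := by
        rw [le_div_iff₀ (by positivity)] at a2; linarith
      have hbd : b ≤ n * p := by
        refine le_trans ?_ hd
        calc b = b * 1 := by ring
          _ ≤ b * b ^ 4 := by gcongr; linarith
          _ = b ^ 5 := by ring
      have hs4 : s ≤ n / 4 := by
        have : s * p * 625 ≤ 1 := le_trans (by gcongr) hps
        have h5 : 1 ≤ n * p := by linarith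
        have : s * p ≤ (n / 4) * p := by linarith
        exact le_of_mul_le_mul_right this h0
      have hb1 : b * (n * p / b) = n * p := by field_simp
      have ht4 : t ≤ n / 4 := by
        have e1 : b * t ≤ s * (n * p) := by
          calc b * t ≤ b * (s * (n * p / b)) := by gcongr
            _ = s * (b * (n * p / b)) := by ring
            _ = s * (n * p) := by rw [hb1]
        have e2 : s * p ≤ 1 := by
          refine le_trans ?_ hps
          exact le_mul_of_one_le_right (by positivity) (by linarith)
        have e3 : s * (n * p) ≤ n := by nlinarith
        nlinarith [Nat.cast_nonneg (α := ℝ) T.card]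
      have hx1 : 1 ≤ n * p / b := by rw [le_div_iff₀ hb0]; linarith
      have hsum : 1 + s + t ≤ 3 * (s * (n * p / b)) := by nlinarith
      push_cast
      calc (1 + s + t) * Real.log n ≤ 3 * (s * (n * p / b)) * Real.log n := by gcongr
        _ = s * (n * p / b) / 2 * (6 * Real.log n) := by ring
        _ ≤ s * (n * p / b) / 2 * b := by gcongr
        _ = s * (b * (n * p / b)) / 2 := by ring
        _ = p * (s * (n / 2)) := by rw [hb1]; ring
        _ ≤ p * (s * ((S ∪ T)ᶜ.card : ℝ)) := by gcongr; linarith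
    · rw [Finset.disjoint_left]
      intro x hx hx'
      simp [hx] at hx'

theorem prob_isSeparated_le (hn : 0 < n) (h0 : 0 < p) (h1 : p ≤ 1) (hb : 5 ≤ b)
    (hlog : 6 * Real.log n ≤ b) (S R : Finset (Fin n)) :
    prob n p (IsSeparated p b S R) ≤ (1 / (n : ℝ)) ^ (1 + S.card + R.card) := by
  have hlog0 : 0 ≤ Real.log n := Real.log_natCast_nonneg n
  refine le_trans (prob_mono h0.le h1 (R := fun G => (Disjoint S R ∧ b / p ≤ S.card ∧
    b / p ≤ R.card) ∧ ∀ x ∈ S, ∀ y ∈ R, ¬ G.Adj x y) ?_)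
    (prob_const_and_le h0.le h1 (by positivity) ?_)
  · rintro G ⟨a1, a2, a3, a4⟩
    exact ⟨⟨a1, a2, a3⟩, a4⟩
  · rintro ⟨a1, a2, a3⟩
    rw [prob_no_edge_between _ _ a1]
    apply one_sub_pow_le hn h1
    rw [div_le_iff₀ h0] at a2 a3
    have hs1 : (1 : ℝ) ≤ S.card := by
      have : (0 : ℝ) < S.card := by
        by_contra hneg
        have : (S.card : ℝ) * p ≤ 0 := mul_nonpos_of_nonpos_of_nonneg (not_lt.1 hneg) h0.le
        linarith
      exact_mod_cast this
    push_cast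
    set s : ℝ := (S.card : ℝ)
    set r : ℝ := (R.card : ℝ)
    have hr0 : 0 ≤ r := Nat.cast_nonneg _
    calc (1 + s + r) * Real.log n ≤ (2 * (s + r)) * Real.log n := by gcongr; linarith
      _ ≤ (s + r) / 2 * (6 * Real.log n) := by
          have : 0 ≤ (s + r) * Real.log n := by positivity
          linarith
      _ ≤ (s + r) / 2 * b := by gcongr
      _ ≤ p * (s * r) := by nlinarith

theorem choose_mul_pow_le {N k : ℕ} (hk : 0 < k) {x : ℝ} (hx : 0 ≤ x)
    (h : N * x * Real.exp (1 + L) ≤ k) : (N.choose k : ℝ) * x ^ k ≤ Real.exp (-(k * L)) := by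
  have hk' : (0 : ℝ) < k := by exact_mod_cast hk
  have h1 : (N.choose k : ℝ) ≤ (N : ℝ) ^ k / k.factorial := Nat.choose_le_pow_div k N
  have h2 : (k : ℝ) ^ k / k.factorial ≤ Real.exp k := Real.pow_div_factorial_le_exp _ hk'.le k
  have hf : (0 : ℝ) < k.factorial := by exact_mod_cast k.factorial_pos
  have h3 : (N * x : ℝ) ≤ k * Real.exp (-(1 + L)) := by
    rw [Real.exp_neg, ← div_eq_mul_inv, le_div_iff₀ (Real.exp_pos _)]
    exact h
  calc (N.choose k : ℝ) * x ^ k ≤ (N : ℝ) ^ k / k.factorial * x ^ k := by gcongr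
    _ = (N * x) ^ k / k.factorial := by rw [mul_pow]; ring
    _ ≤ (k * Real.exp (-(1 + L))) ^ k / k.factorial := by gcongr
    _ = (k : ℝ) ^ k / k.factorial * Real.exp (-(1 + L)) ^ k := by rw [mul_pow]; ring
    _ ≤ Real.exp k * Real.exp (-(1 + L)) ^ k := by gcongr
    _ = Real.exp (-(k * L)) := by
        rw [← Real.exp_nat_mul, ← Real.exp_add]; congr 1; ring

theorem prob_isOverlapping_le (hn : 0 < n) (h0 : 0 < p) (h1 : p ≤ 1) (hb : 5 ≤ b)
    (hL0 : 0 ≤ L) (hLb : Real.exp (1 + L) ≤ b) (hL : 2 * Real.log n ≤ b * L)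
    (S T : Finset (Fin n)) :
    prob n p (IsOverlapping p b S T) ≤ (1 / (n : ℝ)) ^ (1 + S.card + T.card) := by
  have hlog0 : 0 ≤ Real.log n := Real.log_natCast_nonneg n
  set B : ℝ := b * (S.card + T.card + n * p ^ 2 * (S.card * T.card)) with hB
  set k := ⌈B⌉₊ with hk
  refine le_trans (prob_mono h0.le h1 (R := fun G => (Disjoint S T ∧ S.Nonempty) ∧
    ∃ K ∈ ((Finset.powersetCard k Finset.univ).filter fun K => Disjoint K S ∧ Disjoint K T),
      ∀ x ∈ K, (∃ y ∈ S, G.Adj x y) ∧ ∃ z ∈ T, G.Adj x z) ?_)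
    (prob_const_and_le h0.le h1 (by positivity) ?_)
  · rintro G ⟨a1, a2, K, a3, a4, a5, a6⟩
    obtain ⟨K', hK', hc⟩ := Finset.exists_subset_card_eq (s := K) (n := k) (Nat.ceil_le.2 a5)
    refine ⟨⟨a1, a2⟩, K', ?_, fun x hx => a6 x (hK' hx)⟩
    rw [Finset.mem_filter, Finset.mem_powersetCard]
    exact ⟨⟨Finset.subset_univ _, hc⟩, Finset.disjoint_of_subset_left hK' a3,
      Finset.disjoint_of_subset_left hK' a4⟩
  · rintro ⟨a1, a2⟩
    have hs1 : (1 : ℝ) ≤ S.card := by exact_mod_cast Finset.card_pos.2 a2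
    have ht0 : (0 : ℝ) ≤ T.card := Nat.cast_nonneg _
    have hBge : b * (S.card + T.card) ≤ B := by
      have : (0 : ℝ) ≤ n * p ^ 2 * (S.card * T.card) := by positivity
      rw [hB]
      exact mul_le_mul_of_nonneg_left (by linarith) (by linarith)
    have hBpos : 0 < B := by nlinarith
    have hkB : B ≤ k := Nat.le_ceil B
    set x : ℝ := S.card * T.card * p ^ 2 with hx
    refine (prob_exists_le h0.le h1 _ _).trans ?_
    have hle : ∀ K ∈ ((Finset.powersetCard k (Finset.univ : Finset (Fin n))).filter
        fun K => Disjoint K S ∧ Disjoint K T),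
        prob n p (fun G => ∀ x ∈ K, (∃ y ∈ S, G.Adj x y) ∧ ∃ z ∈ T, G.Adj x z) ≤ x ^ k := by
      intro K hK
      rw [Finset.mem_filter, Finset.mem_powersetCard] at hK
      have := prob_forall_common_le h0.le h1 S T K a1 hK.2.1 hK.2.2
      rwa [hK.1.2] at this
    refine (Finset.sum_le_sum hle).trans ?_
    rw [Finset.sum_const, nsmul_eq_mul]
    have hcard : (((Finset.powersetCard k (Finset.univ : Finset (Fin n))).filter
        fun K => Disjoint K S ∧ Disjoint K T).card : ℝ) ≤ n.choose k := by
      have := Finset.card_filter_le (Finset.powersetCard k (Finset.univ : Finset (Fin n)))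
        (fun K => Disjoint K S ∧ Disjoint K T)
      rw [Finset.card_powersetCard, Finset.card_univ, Fintype.card_fin] at this
      exact_mod_cast this
    refine (mul_le_mul_of_nonneg_right hcard (by positivity)).trans ?_
    refine (choose_mul_pow_le (L := L) (Nat.ceil_pos.2 hBpos) (by positivity) ?_).trans
      (exp_neg_le_one_div_pow hn ?_)
    · refine le_trans ?_ hkB
      have : 0 ≤ b * ((S.card : ℝ) + T.card) := by positivity
      calc n * x * Real.exp (1 + L) ≤ n * x * b := by gcongr
        _ ≤ B := by rw [hB, hx]; nlinarith
    · push_cast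
      calc (1 + (S.card : ℝ) + T.card) * Real.log n
          ≤ (S.card + T.card) * (2 * Real.log n) := by nlinarith
        _ ≤ (S.card + T.card) * (b * L) := by gcongr
        _ = b * (S.card + T.card) * L := by ring
        _ ≤ k * L := by gcongr; linarith

theorem expands_of_not_isTrapped {G : SimpleGraph (Fin n)} (h0 : 0 < p) (hb : 5 ≤ b)
    (hd : b ^ 5 ≤ n * p) (h₁ : ¬ ∃ S T, IsTrapped p b S T G)
    (h₂ : ¬ ∃ S T, IsOverlapping p b S T G) :
    Expands G (1 / (p * b ^ 4)) (n * p / b ^ 4) (n * p / b ^ 2) := by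
  classical
  intro S T hST hS hSZ hTZ hTD
  have hb0 : 0 < b := by linarith
  set N := Finset.univ.filter (fun x => x ∉ S ∧ x ∉ T ∧ ∃ y ∈ S, G.Adj y x) with hN
  set K := N.filter (fun x => ∃ z ∈ T, G.Adj x z) with hK
  have memN : ∀ x, x ∈ N ↔ x ∉ S ∧ x ∉ T ∧ ∃ y ∈ S, G.Adj y x := by simp [hN]
  have hbig : (S.card : ℝ) * (n * p / b) < T.card + N.card := by
    by_contra hcon
    refine h₁ ⟨S, T ∪ N, hS, hSZ, ?_, ?_⟩
    · have : ((T ∪ N).card : ℝ) ≤ T.card + N.card := by exact_mod_cast Finset.card_union_le T N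
      linarith
    · intro x hx y hy hy' hxy
      simp only [Finset.mem_union, not_or, memN, not_and] at hy'
      exact hy'.2 hy hy'.1 ⟨x, hx, hxy⟩
  have hKlt : (K.card : ℝ) < b * (S.card + T.card + n * p ^ 2 * (S.card * T.card)) := by
    by_contra hcon
    refine h₂ ⟨S, T, hST, hS, K, ?_, ?_, not_lt.1 hcon, ?_⟩
    · rw [Finset.disjoint_left]
      intro x hx
      exact ((memN x).1 (Finset.mem_filter.1 hx).1).1
    · rw [Finset.disjoint_left]
      intro x hx
      exact ((memN x).1 (Finset.mem_filter.1 hx).1).2.1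
    · intro x hx
      obtain ⟨hx1, hx2⟩ := Finset.mem_filter.1 hx
      obtain ⟨y, hy, hxy⟩ := ((memN x).1 hx1).2.2
      exact ⟨⟨y, hy, hxy.symm⟩, hx2⟩
  refine ⟨N.filter (fun x => ¬ ∃ z ∈ T, G.Adj x z), ?_, ?_⟩
  · have hsplit := Finset.card_filter_add_card_filter_not (s := N) (fun x => ∃ z ∈ T, G.Adj x z)
    have hsplit' : (K.card : ℝ) + (N.filter (fun x => ¬ ∃ z ∈ T, G.Adj x z)).card = N.card := by
      exact_mod_cast hsplit
    have hs1 : (1 : ℝ) ≤ S.card := by exact_mod_cast Finset.card_pos.2 hS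
    set s : ℝ := (S.card : ℝ)
    set t : ℝ := (T.card : ℝ)
    have ht0 : (0 : ℝ) ≤ t := Nat.cast_nonneg _
    set y : ℝ := n * p / b ^ 3 with hy
    have hn0 : (0 : ℝ) ≤ n := Nat.cast_nonneg _
    have hy0 : 0 ≤ y := by positivity
    have e1 : n * p / b = y * b ^ 2 := by rw [hy]; field_simp
    have e2 : n * p / b ^ 2 = y * b := by rw [hy]; field_simp
    have e3 : n * p / b ^ 4 = y / b := by rw [hy]; field_simp
    have hby : b ≤ y := by
      rw [hy, le_div_iff₀ (by positivity)]
      refine le_trans ?_ hd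
      calc b * b ^ 3 = b ^ 4 * 1 := by ring
        _ ≤ b ^ 4 * b := by gcongr; linarith
        _ = b ^ 5 := by ring
    have hbt : b * t ≤ s * y := by
      rw [e3] at hTD
      calc b * t ≤ b * (s * (y / b)) := by gcongr
        _ = s * (b * (y / b)) := by ring
        _ = s * y := by rw [mul_div_cancel₀ _ hb0.ne']
    have hbst : b * (n * p ^ 2 * (s * t)) ≤ s * y := by
      have : t * (p * b ^ 4) ≤ 1 := by rwa [le_div_iff₀ (by positivity)] at hTZ
      have e4 : n * p = y * b ^ 3 := (div_mul_cancel₀ _ (by positivity)).symm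
      calc b * (n * p ^ 2 * (s * t)) = b * ((n * p) * p * (s * t)) := by ring
        _ = s * y * (t * (p * b ^ 4)) := by rw [e4]; ring
        _ ≤ s * y * 1 := mul_le_mul_of_nonneg_left this (mul_nonneg (by linarith) hy0)
        _ = s * y := by ring
    have hbs : b * s ≤ s * y := by nlinarith
    have htt : t ≤ s * y := by nlinarith
    rw [e1] at hbig
    rw [e2]
    have hsy : 0 ≤ s * y := by positivity
    have hfin : s * y * b + 4 * (s * y) ≤ s * y * b ^ 2 := by
      have : b + 4 ≤ b ^ 2 := by nlinarith
      calc s * y * b + 4 * (s * y) = s * y * (b + 4) := by ring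
        _ ≤ s * y * b ^ 2 := by gcongr
    nlinarith
  · intro x hx
    obtain ⟨hx1, hx2⟩ := Finset.mem_filter.1 hx
    obtain ⟨k1, k2, k3⟩ := (memN x).1 hx1
    exact ⟨k1, k2, k3, fun z hz hxz => hx2 ⟨z, hz, hxz⟩⟩

/-- The binomial random graph expands and is well connected with high probability. -/
theorem prob_expands_connects_ge (hn : 0 < n) (h0 : 0 < p) (h1 : p ≤ 1) (hb : 5 ≤ b)
    (hlog : 6 * Real.log n ≤ b) (hd : b ^ 5 ≤ n * p) (hL0 : 0 ≤ L)
    (hLb : Real.exp (1 + L) ≤ b) (hL : 2 * Real.log n ≤ b * L) :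
    1 - 3 * (Real.exp 2 / n) ≤ prob n p (fun G =>
      Expands G (1 / (p * b ^ 4)) (n * p / b ^ 4) (n * p / b ^ 2) ∧ Connects G (b / p)) := by
  have k1 := prob_exists_pair_le h0.le h1 hn _ (prob_isTrapped_le hn h0 h1 hb hlog hd)
  have k2 := prob_exists_pair_le h0.le h1 hn _ (prob_isSeparated_le hn h0 h1 hb hlog)
  have k3 := prob_exists_pair_le h0.le h1 hn _ (prob_isOverlapping_le hn h0 h1 hb hL0 hLb hL)
  have k4 := prob_or_le (n := n) h0.le h1 (fun G => ∃ S T, IsTrapped p b S T G)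
    (fun G => ∃ S T, IsSeparated p b S T G)
  have k5 := prob_or_le (n := n) h0.le h1 (fun G => (∃ S T, IsTrapped p b S T G) ∨
    ∃ S T, IsSeparated p b S T G) (fun G => ∃ S T, IsOverlapping p b S T G)
  have k6 := prob_mono (n := n) h0.le h1 (Q := fun G => ¬ (((∃ S T, IsTrapped p b S T G) ∨
    ∃ S T, IsSeparated p b S T G) ∨ ∃ S T, IsOverlapping p b S T G))
    (R := fun G => Expands G (1 / (p * b ^ 4)) (n * p / b ^ 4) (n * p / b ^ 2) ∧
      Connects G (b / p)) ?_
  · rw [prob_not] at k6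
    linarith
  · intro G hG
    simp only [not_or] at hG
    refine ⟨expands_of_not_isTrapped h0 hb hd hG.1.1 hG.2, fun S R hSR hS hR => ?_⟩
    by_contra hcon
    push Not at hcon
    exact hG.1.2 ⟨S, R, hSR, hS, hR, hcon⟩

end RandomExpansion

/-! ### Asymptotics -/

/-- The numerical conditions of `exists_inducedPath_of_expands` for `q = ⌊x ^ δ⌋`. -/
theorem floor_rpow_bounds {α β ε δ x : ℝ} {t γ : ℕ} (hx : 1 ≤ x) (hδ0 : 0 ≤ δ)
    (hδt : δ * t = α - 5 * ε) (hδ : δ ≤ 1 - α - 5 * ε) (hε : 0 < ε) (hβα : β ≤ α - 5 * ε)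
    (hβ : β ≤ 1 - α - 5 * ε) (h9 : 9 * ε ≤ 1 - α) (hγ : (γ : ℝ) + 1 ≤ x ^ ε)
    (ht : (2 : ℝ) ^ t ≤ x ^ ε) :
    1 ≤ ⌊x ^ δ⌋₊ ∧ (⌊x ^ δ⌋₊ : ℝ) ≤ x ^ (1 - α - 2 * ε) ∧
      x ^ β + γ * (⌊x ^ δ⌋₊ : ℝ) ^ t ≤ x ^ (α - 4 * ε) ∧
      x ^ β + γ * (⌊x ^ δ⌋₊ : ℝ) ≤ x ^ (1 - α - 4 * ε) ∧
      x ^ (α + ε) ≤ (⌊x ^ δ⌋₊ : ℝ) ^ t * x ^ (1 - α - 2 * ε) := by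
  have hx0 : 0 < x := by linarith
  have hone : 1 ≤ x ^ δ := Real.one_le_rpow hx hδ0
  have hq1 : 1 ≤ ⌊x ^ δ⌋₊ := Nat.one_le_floor_iff _ |>.2 hone
  have hq1' : (1 : ℝ) ≤ ⌊x ^ δ⌋₊ := by exact_mod_cast hq1
  have hq : (⌊x ^ δ⌋₊ : ℝ) ≤ x ^ δ := Nat.floor_le (by positivity)
  have hq2 : x ^ δ / 2 ≤ ⌊x ^ δ⌋₊ := by
    have := Nat.lt_floor_add_one (x ^ δ)
    linarith
  set q : ℝ := (⌊x ^ δ⌋₊ : ℝ)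
  have hpow : (x ^ δ) ^ t = x ^ (α - 5 * ε) := by
    rw [← Real.rpow_natCast, ← Real.rpow_mul hx0.le, hδt]
  have hqt : q ^ t ≤ x ^ (α - 5 * ε) := by
    rw [← hpow]; gcongr
  have mono : ∀ {a c : ℝ}, a ≤ c → x ^ a ≤ x ^ c := fun h => Real.rpow_le_rpow_of_exponent_le hx h
  have combine : ∀ {a r s c : ℝ}, r ≤ x ^ a → s ≤ x ^ a → a + ε = c → r + γ * s ≤ x ^ c := by
    intro a r s c hr hs hac
    calc r + γ * s ≤ x ^ a + γ * x ^ a := by gcongr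
      _ = x ^ a * (γ + 1) := by ring
      _ ≤ x ^ a * x ^ ε := by gcongr
      _ = x ^ c := by rw [← Real.rpow_add hx0, hac]
  refine ⟨hq1, hq.trans (mono (by linarith)), combine (mono hβα) hqt (by ring),
    combine (mono hβ) (hq.trans (mono hδ)) (by ring), ?_⟩
  calc x ^ (α + ε) ≤ x ^ (1 - 8 * ε) := mono (by linarith)
    _ = x ^ (1 - 7 * ε) / x ^ ε := by rw [← Real.rpow_sub hx0]; congr 1; ring
    _ ≤ x ^ (1 - 7 * ε) / 2 ^ t := by gcongr
    _ = (x ^ δ / 2) ^ t * x ^ (1 - α - 2 * ε) := by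
        rw [div_pow, hpow, div_mul_eq_mul_div, ← Real.rpow_add hx0]; congr 2; ring
    _ ≤ q ^ t * x ^ (1 - α - 2 * ε) := by gcongr

theorem eventually_natCast_rpow_ge {ε : ℝ} (hε : 0 < ε) (c : ℝ) :
    ∀ᶠ n : ℕ in atTop, c ≤ (n : ℝ) ^ ε :=
  ((tendsto_rpow_atTop hε).comp tendsto_natCast_atTop_atTop).eventually_ge_atTop c

theorem eventually_log_le_rpow {ε : ℝ} (hε : 0 < ε) :
    ∀ᶠ n : ℕ in atTop, 6 * Real.log n ≤ (n : ℝ) ^ ε := by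
  have h := (isLittleO_log_rpow_atTop hε).bound (c := 1 / 6) (by norm_num)
  filter_upwards [tendsto_natCast_atTop_atTop.eventually h] with n hn
  rw [Real.norm_eq_abs, Real.norm_eq_abs, abs_of_nonneg (Real.log_natCast_nonneg n),
    abs_of_nonneg (by positivity)] at hn
  linarith

/-- The random graph `G(n, n^{-α})` expands and is well connected asymptotically almost surely,
in terms of powers of `n`. -/
theorem eventually_prob_expands_connects_ge {α ε : ℝ} (hα : 0 ≤ α) (hε : 0 < ε)
    (h5 : 5 * ε ≤ 1 - α) :
    ∀ᶠ n : ℕ in atTop, 1 - 3 * (Real.exp 2 / n) ≤ prob n ((n : ℝ) ^ (-α)) (fun G =>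
      Expands G ((n : ℝ) ^ (α - 4 * ε)) ((n : ℝ) ^ (1 - α - 4 * ε)) ((n : ℝ) ^ (1 - α - 2 * ε)) ∧
        Connects G ((n : ℝ) ^ (α + ε))) := by
  filter_upwards [eventually_ge_atTop 1, eventually_natCast_rpow_ge hε 5,
    eventually_natCast_rpow_ge hε (4 / ε), eventually_natCast_rpow_ge (half_pos hε) (Real.exp 1),
    eventually_log_le_rpow hε] with n hn hb hb4 hexp hlog
  have hx : (1 : ℝ) ≤ n := by exact_mod_cast hn
  have hx0 : (0 : ℝ) < n := by linarith
  have hlog0 : 0 ≤ Real.log n := Real.log_natCast_nonneg n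
  have bpow : ∀ k : ℕ, ((n : ℝ) ^ ε) ^ k = (n : ℝ) ^ (k * ε) := fun k => by
    rw [← Real.rpow_natCast, ← Real.rpow_mul hx0.le, mul_comm]
  have np : (n : ℝ) * (n : ℝ) ^ (-α) = (n : ℝ) ^ (1 - α) := by
    rw [sub_eq_add_neg, Real.rpow_add hx0, Real.rpow_one]
  have key := prob_expands_connects_ge (n := n) (p := (n : ℝ) ^ (-α)) (b := (n : ℝ) ^ ε)
    (L := ε / 2 * Real.log n) hn (by positivity)
    (Real.rpow_le_one_of_one_le_of_nonpos hx (by linarith)) hb hlog ?_ (by positivity) ?_ ?_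
  · have e1 : 1 / ((n : ℝ) ^ (-α) * ((n : ℝ) ^ ε) ^ 4) = (n : ℝ) ^ (α - 4 * ε) := by
      rw [bpow, ← Real.rpow_add hx0, one_div, ← Real.rpow_neg hx0.le]
      congr 1; push_cast; ring
    have e2 : (n : ℝ) * (n : ℝ) ^ (-α) / ((n : ℝ) ^ ε) ^ 4 = (n : ℝ) ^ (1 - α - 4 * ε) := by
      rw [np, bpow, ← Real.rpow_sub hx0]; norm_num
    have e3 : (n : ℝ) * (n : ℝ) ^ (-α) / ((n : ℝ) ^ ε) ^ 2 = (n : ℝ) ^ (1 - α - 2 * ε) := by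
      rw [np, bpow, ← Real.rpow_sub hx0]; norm_num
    have e4 : (n : ℝ) ^ ε / (n : ℝ) ^ (-α) = (n : ℝ) ^ (α + ε) := by
      rw [← Real.rpow_sub hx0]; congr 1; ring
    rwa [e1, e2, e3, e4] at key
  · rw [np, bpow]
    exact Real.rpow_le_rpow_of_exponent_le hx (by push_cast; linarith)
  · calc Real.exp (1 + ε / 2 * Real.log n) = Real.exp 1 * (n : ℝ) ^ (ε / 2) := by
          rw [Real.exp_add, Real.rpow_def_of_pos hx0, mul_comm (ε / 2)]
      _ ≤ (n : ℝ) ^ (ε / 2) * (n : ℝ) ^ (ε / 2) := by gcongr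
      _ = (n : ℝ) ^ ε := by rw [← Real.rpow_add hx0]; congr 1; ring
  · have : 4 ≤ (n : ℝ) ^ ε * ε := by rwa [div_le_iff₀ hε] at hb4
    nlinarith

/-- Lemma 2.2(b): Let α ∈ (0,1) and 0 < β < min{α, (2/3)(1−α)}. Then for
every sufficiently large integer γ, a.a.s., for every vertex set V of G(n, n^{−α}) with
|V| ≤ n^β and every pair u, v ∈ V, there is an induced path w₁…w_{γ+1} on γ+1 vertices,
all outside V, such that u is the only neighbor of w₁ in V, v is the only neighbor of
w_{γ+1} in V, and w₂,…,w_γ have no neighbors in V. -/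
theorem stmt7 (α : ℝ) (hα0 : 0 < α) (hα1 : α < 1)
    (β : ℝ) (hβ0 : 0 < β) (hβ : β < min α (2 / 3 * (1 - α))) :
    ∃ γ₀ : ℕ, ∀ γ : ℕ, γ₀ ≤ γ →
      Tendsto (fun n : ℕ =>
          prob n ((n : ℝ) ^ (-α)) (fun G =>
            ∀ V : Finset (Fin n), (V.card : ℝ) ≤ (n : ℝ) ^ β →
              ∀ u ∈ V, ∀ v ∈ V,
                ∃ w : Fin (γ + 1) → Fin n,
                  Function.Injective w ∧
                  (∀ i, w i ∉ V) ∧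
                  (∀ i j, G.Adj (w i) (w j) ↔ ((i : ℕ) + 1 = (j : ℕ) ∨ (j : ℕ) + 1 = (i : ℕ))) ∧
                  (∀ x ∈ V, G.Adj (w 0) x ↔ x = u) ∧
                  (∀ x ∈ V, G.Adj (w (Fin.last γ)) x ↔ x = v) ∧
                  (∀ i : Fin (γ + 1), 0 < (i : ℕ) → (i : ℕ) < γ → ∀ x ∈ V, ¬ G.Adj (w i) x)))
        atTop (nhds 1) := by
  obtain ⟨hβα, hβ2⟩ := lt_min_iff.1 hβ
  have hβ1 : β < 1 - α := by linarith
  obtain ⟨ε, hε, hε1, hε2⟩ : ∃ ε > 0, 9 * ε ≤ α - β ∧ 9 * ε ≤ 1 - α - β := by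
    refine ⟨min (α - β) (1 - α - β) / 9, ?_, ?_, ?_⟩
    · have : 0 < min (α - β) (1 - α - β) := lt_min (by linarith) (by linarith)
      positivity
    · have := min_le_left (α - β) (1 - α - β)
      linarith
    · have := min_le_right (α - β) (1 - α - β)
      linarith
  have hα5 : 0 < α - 5 * ε := by linarith
  have hδ5 : 0 < 1 - α - 5 * ε := by linarith
  obtain ⟨t, ht⟩ := exists_nat_gt ((α - 5 * ε) / (1 - α - 5 * ε))
  have ht0 : (0 : ℝ) < t := lt_trans (by positivity) ht
  rw [div_lt_iff₀ hδ5] at ht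
  refine ⟨2 * t + 3, fun γ hγ => ?_⟩
  have hlim : Tendsto (fun n : ℕ => 1 - 3 * (Real.exp 2 / (n : ℝ))) atTop (nhds 1) := by
    have h1 : Tendsto (fun n : ℕ => Real.exp 2 / (n : ℝ)) atTop (nhds 0) :=
      tendsto_const_nhds.div_atTop tendsto_natCast_atTop_atTop
    simpa using (h1.const_mul 3).const_sub 1
  refine tendsto_of_tendsto_of_tendsto_of_le_of_le' hlim tendsto_const_nhds ?_ ?_
  · filter_upwards [eventually_prob_expands_connects_ge hα0.le hε (by linarith),
      eventually_ge_atTop 1, eventually_natCast_rpow_ge hε ((γ : ℝ) + 1),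
      eventually_natCast_rpow_ge hε ((2 : ℝ) ^ t)] with n hprob hn hγn htn
    have hx : (1 : ℝ) ≤ n := by exact_mod_cast hn
    refine hprob.trans (prob_mono (by positivity)
      (Real.rpow_le_one_of_one_le_of_nonpos hx (by linarith)) ?_)
    rintro G ⟨hexp, hcon⟩ V hV u hu v hv
    obtain ⟨k1, k2, k3, k4, k5⟩ := floor_rpow_bounds (α := α) (β := β) (ε := ε)
      (δ := (α - 5 * ε) / t) (t := t) (γ := γ) hx (by positivity) (by field_simp)
      (by rw [div_le_iff₀ ht0]; linarith) hε (by linarith) (by linarith) (by linarith) hγn htn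
    exact exists_inducedPath_of_expands hexp hcon hu hv hγ k1 k2 (by linarith) (by linarith) k5
  · filter_upwards [eventually_ge_atTop 1] with n hn
    have hx : (1 : ℝ) ≤ n := by exact_mod_cast hn
    rw [← prob_true (n := n) (p := (n : ℝ) ^ (-α))]
    exact prob_mono (by positivity) (Real.rpow_le_one_of_one_le_of_nonpos hx (by linarith))
      fun _ _ => trivial
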